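/- arXiv:1706.08333 — 3 statements merged into one kernel-verified Lean document; each statement's English description precedes it below -/
import Mathlib

section
/- Let μ and μ′ be two random permutons. Suppose there exists an integer k₁ ≥ 1 such that for every k ≥ k₁ and every permutation π ∈ 𝔖_k one has E[occ̄(π,μ)] = E[occ̄(π,μ′)]. Then μ and μ′ have the same distribution as random variables with values in the space M of permutons. -/
open MeasureTheory Filter Topology

noncomputable section

/-- `f` is an occurrence of the pattern `π` in `σ`: a strictly increasing choice of positions
whose values are in the same relative order as `π`. -/
def IsOccOf {k n : ℕ} (π : Equiv.Perm (Fin k)) (σ : Equiv.Perm (Fin n))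
    (f : Fin k → Fin n) : Prop :=
  StrictMono f ∧ ∀ i j : Fin k, π i < π j ↔ σ (f i) < σ (f j)

/-- `occ (π, σ)`: the number of occurrences of the pattern `π` in `σ`. -/
def occCount {k n : ℕ} (π : Equiv.Perm (Fin k)) (σ : Equiv.Perm (Fin n)) : ℕ :=
  Nat.card {f : Fin k → Fin n // IsOccOf π σ f}

/-- the pattern density `occ̄ (π, σ) = occ (π, σ) / (n choose k)`. -/
def occDensity {k n : ℕ} (π : Equiv.Perm (Fin k)) (σ : Equiv.Perm (Fin n)) : ℝ :=
  (occCount π σ : ℝ) / (n.choose k : ℝ)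


/-- The space of Borel probability measures on `ℝ × ℝ`. -/
abbrev PM2 := MeasureTheory.ProbabilityMeasure (ℝ × ℝ)

/-- A permuton: a probability measure on the unit square with uniform marginals. -/
def IsPermuton (μ : PM2) : Prop :=
  (μ : MeasureTheory.Measure (ℝ × ℝ)).map Prod.fst
      = MeasureTheory.volume.restrict (Set.Icc (0:ℝ) 1) ∧
  (μ : MeasureTheory.Measure (ℝ × ℝ)).map Prod.snd
      = MeasureTheory.volume.restrict (Set.Icc (0:ℝ) 1)

/-- The space `M` of permutons, with the topology of weak convergence of measures. -/
def Permuton : Type := {μ : PM2 // IsPermuton μ}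

instance : TopologicalSpace Permuton := instTopologicalSpaceSubtype
instance : MeasurableSpace Permuton := borel Permuton
instance : BorelSpace Permuton := ⟨rfl⟩

/-- The underlying measure of a permuton. -/
def Permuton.meas (μ : Permuton) : MeasureTheory.Measure (ℝ × ℝ) :=
  (μ.1 : MeasureTheory.Measure (ℝ × ℝ))

/-- The `k` points `p` (with pairwise distinct `x`- and `y`-coordinates) induce the
pattern `π`: after sorting the points by increasing `x`-coordinate, the ranks of the
`y`-coordinates form the permutation `π`. -/
def InducesPattern {k : ℕ} (π : Equiv.Perm (Fin k)) (p : Fin k → ℝ × ℝ) : Prop :=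
  ∃ g : Equiv.Perm (Fin k), StrictMono (fun i => (p (g i)).1) ∧
    ∀ i j : Fin k, ((p (g i)).2 < (p (g j)).2 ↔ π i < π j)

/-- The pattern density `occ̄ (π, μ)` of `π` in a permuton `μ`:
the `μ^{⊗k}`-measure of the set of `k`-tuples of points inducing the pattern `π`. -/
def permutonOcc {k : ℕ} (π : Equiv.Perm (Fin k)) (μ : Permuton) : ℝ :=
  ((MeasureTheory.Measure.pi fun _ : Fin k => μ.meas) {p | InducesPattern π p}).toReal

/-- The expected pattern density `E[occ̄ (π, ·)]` of a random permuton, given by its law `m`. -/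
def epd {k : ℕ} (π : Equiv.Perm (Fin k)) (m : MeasureTheory.ProbabilityMeasure Permuton) : ℝ :=
  ∫ μ, permutonOcc π μ ∂(m : MeasureTheory.Measure Permuton)

instance (μ : Permuton) : IsProbabilityMeasure μ.meas :=
  inferInstanceAs (IsProbabilityMeasure (μ.1 : Measure (ℝ × ℝ)))

/-- The strict order relations between the first, resp. second, coordinates of a family of
points. -/
def orderPattern {ι : Type*} (p : ι → ℝ × ℝ) : (ι → ι → Prop) × (ι → ι → Prop) :=
  (fun i j ↦ (p i).1 < (p j).1, fun i j ↦ (p i).2 < (p j).2)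

/-- The strict order relation pulled back along a permutation. -/
def permLT {n : ℕ} (α : Equiv.Perm (Fin n)) (i j : Fin n) : Prop := α i < α j

lemma measurableSet_orderPattern_preimage {ι : Type*} [Finite ι]
    (T : Set ((ι → ι → Prop) × (ι → ι → Prop))) :
    MeasurableSet (orderPattern ⁻¹' T : Set (ι → ℝ × ℝ)) := by
  have : Measurable (orderPattern : (ι → ℝ × ℝ) → _) := by
    refine Measurable.prodMk ?_ ?_ <;>
    · refine measurable_pi_iff.2 fun i ↦ measurable_pi_iff.2 fun j ↦ ?_
      exact measurableSet_setOfPred.1 (measurableSet_lt (by fun_prop) (by fun_prop))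
  exact this T.toFinite.measurableSet

lemma permLT_injective {n : ℕ} : Function.Injective (permLT (n := n)) := by
  intro α β h
  have hmono : StrictMono (β ∘ α.symm) := fun i j hij ↦ by
    have := congrFun (congrFun h (α.symm i)) (α.symm j)
    simpa [permLT, hij] using this
  have hid := Subsingleton.elim (StrictMono.orderIsoOfSurjective _ hmono
    (β.surjective.comp α.symm.surjective)) (OrderIso.refl (Fin n))
  ext i
  have := congrArg (fun e ↦ (e (α i) : ℕ)) hid
  simpa using this.symm

lemma exists_permLT_eq {n : ℕ} {x : Fin n → ℝ} (hx : Function.Injective x) :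
    ∃ α : Equiv.Perm (Fin n), ∀ i j, x i < x j ↔ permLT α i j := by
  refine ⟨(Tuple.sort x).symm, fun i j ↦ ?_⟩
  have hmono : StrictMono (x ∘ Tuple.sort x) :=
    (Tuple.monotone_sort x).strictMono_of_injective (hx.comp (Tuple.sort x).injective)
  have := hmono.lt_iff_lt (a := (Tuple.sort x).symm i) (b := (Tuple.sort x).symm j)
  simpa [permLT] using this

lemma inducesPattern_iff {n : ℕ} (π : Equiv.Perm (Fin n)) (p : Fin n → ℝ × ℝ) :
    InducesPattern π p ↔
      ∃ α : Equiv.Perm (Fin n), orderPattern p = (permLT α, permLT (α.trans π)) := by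
  constructor
  · rintro ⟨g, hg, h⟩
    refine ⟨g.symm, Prod.ext ?_ ?_⟩ <;> ext i j
    · simpa [orderPattern, permLT] using hg.lt_iff_lt (a := g.symm i) (b := g.symm j)
    · simpa [orderPattern, permLT] using h (g.symm i) (g.symm j)
  · rintro ⟨α, h⟩
    simp only [orderPattern, Prod.mk.injEq] at h
    refine ⟨α.symm, fun i j hij ↦ ?_, fun i j ↦ ?_⟩
    · simpa [permLT, hij] using congrFun (congrFun h.1 (α.symm i)) (α.symm j)
    · simpa [permLT] using congrFun (congrFun h.2 (α.symm i)) (α.symm j)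

lemma ae_injective_of_eq_restrict_Icc {n : ℕ} {ν : Measure ℝ}
    (hν : ν = volume.restrict (Set.Icc (0 : ℝ) 1)) :
    ∀ᵐ x ∂(Measure.pi fun _ : Fin n ↦ ν), Function.Injective x := by
  subst hν
  rw [← Measure.restrict_pi_pi]
  refine ae_restrict_of_ae ?_
  have key (i j : Fin n) : ∀ᵐ x ∂(Measure.pi fun _ : Fin n ↦ (volume : Measure ℝ)),
      x i = x j → i = j := by
    by_cases hij : i = j
    · simp [hij]
    let L : (Fin n → ℝ) →ₗ[ℝ] ℝ :=
      (LinearMap.proj i : (Fin n → ℝ) →ₗ[ℝ] ℝ) - LinearMap.proj j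
    have hL : LinearMap.ker L ≠ ⊤ := by
      intro h
      have : Pi.single i (1 : ℝ) ∈ LinearMap.ker L := h ▸ Submodule.mem_top
      simp [L, Ne.symm hij] at this
    have := Measure.addHaar_submodule (volume : Measure (Fin n → ℝ)) _ hL
    rw [ae_iff]
    convert! this using 2
    ext x
    simp [L, sub_eq_zero, hij]
  filter_upwards [ae_all_iff.2 fun i ↦ ae_all_iff.2 fun j ↦ key i j] with x hx i j
  exact hx i j

lemma ae_exists_orderPattern_eq (n : ℕ) (μ : Permuton) :
    ∀ᵐ p ∂(Measure.pi fun _ : Fin n ↦ μ.meas),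
      ∃ α β : Equiv.Perm (Fin n), orderPattern p = (permLT α, permLT β) := by
  have coord (f : ℝ × ℝ → ℝ) (hf : Measurable f)
      (hμ : μ.meas.map f = volume.restrict (Set.Icc (0 : ℝ) 1)) :
      ∀ᵐ p ∂(Measure.pi fun _ : Fin n ↦ μ.meas), Function.Injective fun i ↦ f (p i) := by
    have h := ae_injective_of_eq_restrict_Icc (n := n) hμ
    have : ∀ _ : Fin n, SigmaFinite (μ.meas.map f) := fun _ ↦
      have := Measure.isProbabilityMeasure_map (μ := μ.meas) hf.aemeasurable
      inferInstance
    rw [← Measure.pi_map_pi fun _ ↦ hf.aemeasurable] at h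
    exact ae_of_ae_map (measurable_pi_lambda _ fun i ↦
      hf.comp (measurable_pi_apply i)).aemeasurable h
  filter_upwards [coord _ measurable_fst μ.2.1, coord _ measurable_snd μ.2.2] with p h₁ h₂
  obtain ⟨α, hα⟩ := exists_permLT_eq h₁
  obtain ⟨β, hβ⟩ := exists_permLT_eq h₂
  refine ⟨α, β, Prod.ext ?_ ?_⟩ <;> ext i j
  exacts [hα i j, hβ i j]

/-- The probability that i.i.d. points drawn from `μ` have an order pattern in `T`. -/
def orderDensity {ι : Type*} [Fintype ι] (T : Set ((ι → ι → Prop) × (ι → ι → Prop)))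
    (μ : Permuton) : ℝ :=
  (Measure.pi fun _ : ι ↦ μ.meas).real (orderPattern ⁻¹' T)

lemma measurePreserving_comp_equiv {ι κ : Type*} [Fintype ι] [Fintype κ] (e : κ ≃ ι)
    (μ : Permuton) :
    MeasurePreserving (fun (p : κ → ℝ × ℝ) ↦ p ∘ e.symm)
      (Measure.pi fun _ ↦ μ.meas) (Measure.pi fun _ ↦ μ.meas) := by
  convert! measurePreserving_piCongrLeft (fun _ : ι ↦ μ.meas) e using 1
  ext p i : 2
  obtain ⟨j, rfl⟩ := e.surjective i
  simp [MeasurableEquiv.coe_piCongrLeft]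

lemma orderDensity_reindex {ι κ : Type*} [Fintype ι] [Fintype κ] (e : κ ≃ ι)
    (T : Set ((ι → ι → Prop) × (ι → ι → Prop))) (μ : Permuton) :
    orderDensity {r | ((fun i j ↦ r.1 (e.symm i) (e.symm j)),
      (fun i j ↦ r.2 (e.symm i) (e.symm j))) ∈ T} μ = orderDensity T μ :=
  (measurePreserving_comp_equiv e μ).measureReal_preimage
    (measurableSet_orderPattern_preimage T).nullMeasurableSet

lemma orderDensity_permLT_trans {n : ℕ} (α π : Equiv.Perm (Fin n)) (μ : Permuton) :
    orderDensity {(permLT α, permLT (α.trans π))} μ =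
      orderDensity {(permLT (Equiv.refl _), permLT π)} μ := by
  rw [← orderDensity_reindex α {(permLT (Equiv.refl _), permLT π)}]
  congr 1
  ext ⟨r, s⟩
  simp only [Set.mem_singleton_iff, Prod.mk.injEq, Set.mem_ofPred_eq]
  refine and_congr ⟨?_, fun h ↦ ?_⟩ ⟨?_, fun h ↦ ?_⟩
  · rintro rfl; ext; simp [permLT]
  · ext i j; simpa [permLT] using congrFun (congrFun h (α i)) (α j)
  · rintro rfl; ext; simp [permLT]
  · ext i j; simpa [permLT] using congrFun (congrFun h (α i)) (α j)

open scoped Classical in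
lemma orderDensity_eq_sum {n : ℕ}
    (T : Set ((Fin n → Fin n → Prop) × (Fin n → Fin n → Prop))) (μ : Permuton) :
    orderDensity T μ = ∑ a : Equiv.Perm (Fin n) × Equiv.Perm (Fin n) with
      (permLT a.1, permLT a.2) ∈ T, orderDensity {(permLT a.1, permLT a.2)} μ := by
  have hae : (orderPattern ⁻¹' T : Set (Fin n → ℝ × ℝ)) =ᵐ[Measure.pi fun _ : Fin n ↦ μ.meas]
      ⋃ a ∈ ({a | (permLT a.1, permLT a.2) ∈ T} :
        Finset (Equiv.Perm (Fin n) × Equiv.Perm (Fin n))),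
        orderPattern ⁻¹' {(permLT a.1, permLT a.2)} := by
    filter_upwards [ae_exists_orderPattern_eq n μ] with p hp
    obtain ⟨α, β, h⟩ := hp
    apply propext
    change orderPattern p ∈ T ↔ p ∈ (⋃ a ∈ _, _)
    simp only [Set.mem_iUnion, Finset.mem_filter, Finset.mem_univ, true_and, Set.mem_preimage,
      Set.mem_singleton_iff, exists_prop]
    constructor
    · exact fun hT ↦ ⟨(α, β), h ▸ hT, h⟩
    · rintro ⟨a, ha, h'⟩
      exact h' ▸ ha
  rw [orderDensity, measureReal_congr hae, measureReal_biUnion_finset]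
  · rfl
  · intro a _ b _ hab
    refine Set.disjoint_left.2 fun p hp hq ↦ hab ?_
    have := hp.symm.trans hq
    simp only [Prod.mk.injEq] at this
    exact Prod.ext (permLT_injective this.1) (permLT_injective this.2)
  · exact fun a _ ↦ measurableSet_orderPattern_preimage _

lemma permutonOcc_eq {n : ℕ} (π : Equiv.Perm (Fin n)) (μ : Permuton) :
    permutonOcc π μ =
      n.factorial * orderDensity {(permLT (Equiv.refl _), permLT π)} μ := by
  classical
  have h : permutonOcc π μ = orderDensity
      {r | ∃ α : Equiv.Perm (Fin n), r = (permLT α, permLT (α.trans π))} μ := by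
    simp only [permutonOcc, orderDensity, inducesPattern_iff]
    rfl
  rw [h, orderDensity_eq_sum]
  refine (Finset.sum_congr (s₂ := Finset.univ.image fun α ↦ (α, α.trans π)) ?_
    fun _ _ ↦ rfl).trans ?_
  · ext ⟨α, β⟩
    simp only [Set.mem_ofPred_eq, Prod.mk.injEq, Finset.mem_filter, Finset.mem_univ, true_and,
      Finset.mem_image, permLT_injective.eq_iff]
    grind
  · rw [Finset.sum_image fun _ _ _ _ h ↦ congrArg Prod.fst h]
    simp [orderDensity_permLT_trans, Fintype.card_perm]

open scoped Classical in
lemma orderDensity_eq_sum_permutonOcc {n : ℕ}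
    (T : Set ((Fin n → Fin n → Prop) × (Fin n → Fin n → Prop))) (μ : Permuton) :
    orderDensity T μ = ∑ a : Equiv.Perm (Fin n) × Equiv.Perm (Fin n) with
      (permLT a.1, permLT a.2) ∈ T, (n.factorial : ℝ)⁻¹ * permutonOcc (a.1.symm.trans a.2) μ := by
  rw [orderDensity_eq_sum]
  refine Finset.sum_congr rfl fun a _ ↦ ?_
  have h := orderDensity_permLT_trans a.1 (a.1.symm.trans a.2) μ
  rw [← Equiv.trans_assoc, Equiv.self_trans_symm, Equiv.refl_trans] at h
  rw [h, permutonOcc_eq, inv_mul_cancel_left₀ (by positivity)]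

lemma measurable_permuton_meas : Measurable Permuton.meas := by
  refine Measurable.measure_of_isPiSystem_of_isProbabilityMeasure
    (BorelSpace.measurable_eq.trans borel_eq_generateFrom_isClosed) isPiSystem_isClosed
    fun F hF ↦ ?_
  refine measurable_of_tendsto_metrizable (f := fun N (μ : Permuton) ↦
    ∫⁻ x, (IsClosed.apprSeq hF N x : ENNReal) ∂μ.meas) (fun N ↦ ?_) ?_
  · refine Continuous.measurable ?_
    refine (ENNReal.continuous_coe.comp
      ((ProbabilityMeasure.continuous_testAgainstNN_eval (IsClosed.apprSeq hF N)).comp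
        (continuous_subtype_val (p := IsPermuton)))).congr fun μ ↦ ?_
    exact FiniteMeasure.testAgainstNN_coe_eq
  · exact tendsto_pi_nhds.2 fun μ ↦ HasOuterApproxClosed.tendsto_lintegral_apprSeq hF μ.meas

lemma measurable_orderDensity {ι : Type*} [Fintype ι]
    (T : Set ((ι → ι → Prop) × (ι → ι → Prop))) : Measurable (orderDensity T) := by
  have : Measurable fun μ : Permuton ↦ Measure.pi fun _ : ι ↦ μ.meas := by
    refine Measurable.measure_of_isPiSystem_of_isProbabilityMeasure generateFrom_pi.symm
      isPiSystem_pi ?_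
    rintro _ ⟨s, hs, rfl⟩
    simp only [Measure.pi_pi]
    exact Finset.measurable_fun_prod _ fun i _ ↦
      Measure.measurable_measure.1 measurable_permuton_meas _ (hs i trivial)
  exact (Measure.measurable_measure.1 this _
    (measurableSet_orderPattern_preimage T)).ennreal_toReal

lemma integrable_orderDensity {ι : Type*} [Fintype ι]
    (T : Set ((ι → ι → Prop) × (ι → ι → Prop))) (m : ProbabilityMeasure Permuton) :
    Integrable (orderDensity T) (m : Measure Permuton) :=
  Integrable.of_bound (measurable_orderDensity T).aestronglyMeasurable 1 <|
    ae_of_all _ fun _ ↦ (Real.norm_of_nonneg measureReal_nonneg).trans_le measureReal_le_one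

lemma integrable_permutonOcc {n : ℕ} (π : Equiv.Perm (Fin n))
    (m : ProbabilityMeasure Permuton) : Integrable (permutonOcc π) (m : Measure Permuton) := by
  rw [funext (permutonOcc_eq π)]
  exact (integrable_orderDensity _ m).const_mul _

lemma integral_orderDensity_eq {m m' : ProbabilityMeasure Permuton} {n : ℕ}
    (h : ∀ π : Equiv.Perm (Fin n), epd π m = epd π m')
    (T : Set ((Fin n → Fin n → Prop) × (Fin n → Fin n → Prop))) :
    ∫ μ, orderDensity T μ ∂(m : Measure Permuton) =
      ∫ μ, orderDensity T μ ∂(m' : Measure Permuton) := by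
  simp only [orderDensity_eq_sum_permutonOcc]
  rw [integral_finsetSum _ fun a _ ↦ (integrable_permutonOcc _ m).const_mul _,
    integral_finsetSum _ fun a _ ↦ (integrable_permutonOcc _ m').const_mul _]
  refine Finset.sum_congr rfl fun a _ ↦ ?_
  rw [integral_const_mul, integral_const_mul]
  exact congrArg _ (h _)

lemma orderDensity_mul {ι κ : Type*} [Fintype ι] [Fintype κ]
    (S : Set ((ι → ι → Prop) × (ι → ι → Prop))) (T : Set ((κ → κ → Prop) × (κ → κ → Prop)))
    (μ : Permuton) :
    orderDensity S μ * orderDensity T μ = orderDensity (ι := ι ⊕ κ)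
      {r | ((fun i j ↦ r.1 (.inl i) (.inl j)), (fun i j ↦ r.2 (.inl i) (.inl j))) ∈ S ∧
        ((fun i j ↦ r.1 (.inr i) (.inr j)), (fun i j ↦ r.2 (.inr i) (.inr j))) ∈ T} μ := by
  rw [orderDensity, orderDensity, ← measureReal_prod_prod]
  exact ((measurePreserving_sumPiEquivProdPi fun _ : ι ⊕ κ ↦ μ.meas).measureReal_preimage
    ((measurableSet_orderPattern_preimage S).prod
      (measurableSet_orderPattern_preimage T)).nullMeasurableSet).symm

lemma orderDensity_univ {ι : Type*} [Fintype ι] (μ : Permuton) :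
    orderDensity (ι := ι) Set.univ μ = 1 := by
  simp [orderDensity]

/-- Functions on permutons given by the probability of an event on the relative order of finitely
many i.i.d. points. -/
def IsPatternFunctional (F : Permuton → ℝ) : Prop :=
  ∃ (n : ℕ) (T : Set ((Fin n → Fin n → Prop) × (Fin n → Fin n → Prop))), F = orderDensity T

lemma isPatternFunctional_orderDensity {ι : Type*} [Fintype ι]
    (T : Set ((ι → ι → Prop) × (ι → ι → Prop))) : IsPatternFunctional (orderDensity T) :=
  ⟨Fintype.card ι, _, funext fun μ ↦
    (orderDensity_reindex (Fintype.equivFin ι).symm T μ).symm⟩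

lemma IsPatternFunctional.one : IsPatternFunctional 1 :=
  ⟨0, Set.univ, funext fun μ ↦ (orderDensity_univ μ).symm⟩

lemma IsPatternFunctional.mul {F G : Permuton → ℝ} (hF : IsPatternFunctional F)
    (hG : IsPatternFunctional G) : IsPatternFunctional (F * G) := by
  obtain ⟨n, S, rfl⟩ := hF
  obtain ⟨k, T, rfl⟩ := hG
  rw [show orderDensity S * orderDensity T = _ from funext (orderDensity_mul S T)]
  exact isPatternFunctional_orderDensity _

lemma IsPatternFunctional.measurable {F : Permuton → ℝ} (hF : IsPatternFunctional F) :
    Measurable F := by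
  obtain ⟨n, T, rfl⟩ := hF
  exact measurable_orderDensity T

lemma IsPatternFunctional.mem_Icc {F : Permuton → ℝ} (hF : IsPatternFunctional F)
    (μ : Permuton) : F μ ∈ Set.Icc (0 : ℝ) 1 := by
  obtain ⟨n, T, rfl⟩ := hF
  exact ⟨measureReal_nonneg, measureReal_le_one⟩

lemma IsPatternFunctional.integral_eq {m m' : ProbabilityMeasure Permuton} {k : ℕ}
    (h : ∀ n : ℕ, k ≤ n → ∀ π : Equiv.Perm (Fin n), epd π m = epd π m')
    {F : Permuton → ℝ} (hF : IsPatternFunctional F) :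
    ∫ μ, F μ ∂(m : Measure Permuton) = ∫ μ, F μ ∂(m' : Measure Permuton) := by
  obtain ⟨n, T, rfl⟩ := hF
  have key (μ : Permuton) := ((orderDensity_reindex finSumFinEquiv.symm _ μ).trans
    (orderDensity_mul T (Set.univ : Set ((Fin k → Fin k → Prop) × _)) μ).symm).trans
    ((congrArg _ (orderDensity_univ μ)).trans (mul_one _))
  simp_rw [← key]
  exact integral_orderDensity_eq (h _ (Nat.le_add_left k n)) _

/-- The mixed moments of a permuton. -/
def Permuton.moment (a : ℕ × ℕ) (μ : Permuton) : ℝ :=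
  ∫ z, z.1 ^ a.1 * z.2 ^ a.2 ∂μ.meas

lemma measure_lt_eq_ofReal {μ : Measure (ℝ × ℝ)} {f : ℝ × ℝ → ℝ} (hf : Measurable f)
    (h : μ.map f = volume.restrict (Set.Icc (0 : ℝ) 1)) {t : ℝ} (ht : t ∈ Set.Icc (0 : ℝ) 1) :
    μ {z | f z < t} = ENNReal.ofReal t := by
  have : μ.map f (Set.Iio t) = μ {z | f z < t} := Measure.map_apply hf measurableSet_Iio
  rw [← this, h, Measure.restrict_apply measurableSet_Iio]
  have : Set.Iio t ∩ Set.Icc 0 1 = Set.Ico 0 t := by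
    ext x; simp only [Set.mem_inter_iff, Set.mem_Iio, Set.mem_Icc, Set.mem_Ico]
    grind
  simp [this]

lemma Permuton.ae_mem_unitSquare (μ : Permuton) :
    ∀ᵐ z ∂μ.meas, z ∈ Set.Icc (0 : ℝ) 1 ×ˢ Set.Icc (0 : ℝ) 1 := by
  have coord (f : ℝ × ℝ → ℝ) (hf : Measurable f)
      (h : μ.meas.map f = volume.restrict (Set.Icc (0 : ℝ) 1)) :
      ∀ᵐ z ∂μ.meas, f z ∈ Set.Icc (0 : ℝ) 1 :=
    ae_of_ae_map hf.aemeasurable (h ▸ ae_restrict_mem measurableSet_Icc)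
  filter_upwards [coord _ measurable_fst μ.2.1, coord _ measurable_snd μ.2.2] with z h₁ h₂
  exact ⟨h₁, h₂⟩

lemma Permuton.moment_eq_orderDensity (a : ℕ × ℕ) (μ : Permuton) :
    μ.moment a = orderDensity (ι := Unit ⊕ (Fin a.1 ⊕ Fin a.2))
      {r | (∀ i, r.1 (.inr (.inl i)) (.inl ())) ∧ ∀ j, r.2 (.inr (.inr j)) (.inl ())} μ := by
  let box (z : ℝ × ℝ) : Set (Fin a.1 ⊕ Fin a.2 → ℝ × ℝ) :=
    Set.univ.pi (Sum.elim (fun _ ↦ {w | w.1 < z.1}) (fun _ ↦ {w | w.2 < z.2}))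
  have hbox : ∀ᵐ z ∂μ.meas, (Measure.pi fun _ ↦ μ.meas).real (box z) = z.1 ^ a.1 * z.2 ^ a.2 := by
    filter_upwards [μ.ae_mem_unitSquare] with z hz
    rw [measureReal_def, Measure.pi_pi]
    simp [measure_lt_eq_ofReal (μ := μ.meas) measurable_fst μ.2.1 hz.1,
      measure_lt_eq_ofReal (μ := μ.meas) measurable_snd μ.2.2 hz.2, hz.1.1, hz.2.1]
  let T : Set ((Unit ⊕ (Fin a.1 ⊕ Fin a.2) → Unit ⊕ (Fin a.1 ⊕ Fin a.2) → Prop) ×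
    (Unit ⊕ (Fin a.1 ⊕ Fin a.2) → Unit ⊕ (Fin a.1 ⊕ Fin a.2) → Prop)) :=
    {r | (∀ i, r.1 (.inr (.inl i)) (.inl ())) ∧ ∀ j, r.2 (.inr (.inr j)) (.inl ())}
  have hT := measurableSet_orderPattern_preimage T
  have e := measurePreserving_sumPiEquivProdPi_symm fun _ : Unit ⊕ (Fin a.1 ⊕ Fin a.2) ↦ μ.meas
  have hsection (z : ℝ × ℝ) : box z = Prod.mk ((MeasurableEquiv.funUnique Unit (ℝ × ℝ)).symm z) ⁻¹'
      ((MeasurableEquiv.sumPiEquivProdPi fun _ : Unit ⊕ (Fin a.1 ⊕ Fin a.2) ↦ ℝ × ℝ).symm ⁻¹'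
        (orderPattern ⁻¹' T)) := by
    ext p
    change _ ↔ (∀ i, (p (.inl i)).1 < z.1) ∧ ∀ j, (p (.inr j)).2 < z.2
    simp [box, Set.mem_pi]
  have hmeas : Measurable fun z ↦ (Measure.pi fun _ ↦ μ.meas) (box z) := by
    simp_rw [hsection]
    exact (measurable_measure_prodMk_left (e.measurable hT)).comp
      (MeasurableEquiv.funUnique Unit (ℝ × ℝ)).symm.measurable
  calc μ.moment a = ∫ z, (Measure.pi fun _ ↦ μ.meas).real (box z) ∂μ.meas :=
        integral_congr_ae (hbox.mono fun _ h ↦ h.symm)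
    _ = (∫⁻ z, (Measure.pi fun _ ↦ μ.meas) (box z) ∂μ.meas).toReal :=
        integral_toReal hmeas.aemeasurable (ae_of_all _ fun _ ↦ measure_lt_top _ _)
    _ = orderDensity T μ := by
        rw [orderDensity, ← e.measureReal_preimage hT.nullMeasurableSet, measureReal_def,
          Measure.prod_apply (e.measurable hT),
          ← (measurePreserving_funUnique μ.meas Unit).symm.lintegral_comp_emb
            (MeasurableEquiv.measurableEmbedding _)]
        simp_rw [hsection]

lemma Permuton.isPatternFunctional_moment (a : ℕ × ℕ) :
    IsPatternFunctional (Permuton.moment a) := by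
  rw [funext (Permuton.moment_eq_orderDensity a)]
  exact isPatternFunctional_orderDensity _

/-- The family of all mixed moments of a permuton. -/
def Permuton.momentMap (μ : Permuton) (a : ℕ × ℕ) : Set.Icc (0 : ℝ) 1 :=
  ⟨μ.moment a, (Permuton.isPatternFunctional_moment a).mem_Icc μ⟩

lemma Permuton.measurable_momentMap : Measurable Permuton.momentMap :=
  measurable_pi_lambda _ fun a ↦ (Permuton.isPatternFunctional_moment a).measurable.subtype_mk

lemma Permuton.integrable_continuousMap (μ : Permuton) (g : C(ℝ × ℝ, ℝ)) :
    Integrable g μ.meas := by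
  have := g.continuous.continuousOn.integrableOn_compact (μ := μ.meas)
    ((isCompact_Icc (a := (0 : ℝ)) (b := 1)).prod (isCompact_Icc (a := (0 : ℝ)) (b := 1)))
  rwa [IntegrableOn, Measure.restrict_eq_self_of_ae_mem μ.ae_mem_unitSquare] at this

/-- The algebra of polynomial functions on the plane. -/
def planePolynomials : Subalgebra ℝ C(ℝ × ℝ, ℝ) :=
  Algebra.adjoin ℝ {ContinuousMap.fst, ContinuousMap.snd}

lemma planePolynomials_separatesPoints : planePolynomials.SeparatesPoints := by
  intro x y hxy
  by_cases h : x.1 = y.1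
  · exact ⟨_, ⟨ContinuousMap.snd, Algebra.subset_adjoin (by simp), rfl⟩,
      fun h' ↦ hxy (Prod.ext h h')⟩
  · exact ⟨_, ⟨ContinuousMap.fst, Algebra.subset_adjoin (by simp), rfl⟩, h⟩

lemma Permuton.tendsto_integral_planePolynomials (ν : Permuton) {g : C(ℝ × ℝ, ℝ)}
    (hg : g ∈ planePolynomials) :
    Tendsto (fun μ : Permuton ↦ ∫ z, g z ∂μ.meas) (comap momentMap (𝓝 ν.momentMap))
      (𝓝 (∫ z, g z ∂ν.meas)) := by
  rw [planePolynomials, ← Subalgebra.mem_toSubmodule, Algebra.adjoin_eq_span] at hg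
  induction hg using Submodule.span_induction with
  | mem g hg =>
    obtain ⟨a, b, rfl⟩ := (Submonoid.mem_closure_pair _ _ _).1 hg
    have h := (continuous_subtype_val.comp (continuous_apply (a, b))).continuousAt.tendsto.comp
      (tendsto_comap (f := momentMap) (x := 𝓝 ν.momentMap))
    exact h
  | zero => simpa using tendsto_const_nhds
  | add f g _ _ hf hg =>
    simp only [ContinuousMap.add_apply]
    simp_rw [integral_add (integrable_continuousMap _ f) (integrable_continuousMap _ g)]
    exact hf.add hg
  | smul c g _ hg =>
    simp only [ContinuousMap.smul_apply, integral_smul]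
    exact hg.const_smul c

lemma Permuton.tendsto_comap_momentMap (ν : Permuton) :
    Tendsto id (comap momentMap (𝓝 ν.momentMap)) (𝓝 ν) := by
  have hval : Topology.IsInducing (Subtype.val : Permuton → PM2) := ⟨rfl⟩
  refine hval.tendsto_nhds_iff.2 ?_
  refine ProbabilityMeasure.tendsto_iff_forall_integral_tendsto.2 fun f ↦ ?_
  refine Metric.tendsto_nhds.2 fun ε hε ↦ ?_
  obtain ⟨g, hg, hfg⟩ :=
    ContinuousMap.exists_mem_subalgebra_near_continuous_of_isCompact_of_separatesPoints
      planePolynomials_separatesPoints f.toContinuousMap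
      ((isCompact_Icc (a := (0 : ℝ)) (b := 1)).prod (isCompact_Icc (a := (0 : ℝ)) (b := 1)))
      (show 0 < ε / 3 by positivity)
  have hclose (μ : Permuton) : dist (∫ z, g z ∂μ.meas) (∫ z, f z ∂μ.meas) ≤ ε / 3 := by
    rw [dist_eq_norm, ← integral_sub (μ.integrable_continuousMap g)
      (show Integrable f μ.meas from μ.integrable_continuousMap f.toContinuousMap)]
    refine (norm_integral_le_of_norm_le_const (μ.ae_mem_unitSquare.mono fun z hz ↦
      (hfg z hz).le)).trans_eq ?_
    simp
  filter_upwards [Metric.tendsto_nhds.1 (ν.tendsto_integral_planePolynomials hg) (ε / 3)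
    (by positivity)] with μ hμ
  have h₁ := hclose μ
  have h₂ := hclose ν
  rw [dist_comm] at h₁
  change dist (∫ z, f z ∂μ.meas) (∫ z, f z ∂ν.meas) < ε
  calc _ ≤ _ := dist_triangle4 _ (∫ z, g z ∂μ.meas) (∫ z, g z ∂ν.meas) _
    _ < ε := by linarith

lemma Permuton.measurableSpace_le_comap_momentMap :
    (inferInstance : MeasurableSpace Permuton) ≤ MeasurableSpace.comap momentMap inferInstance := by
  rw [BorelSpace.measurable_eq (α := ℕ × ℕ → Set.Icc (0 : ℝ) 1), ← borel_comap]
  refine borel_anti (le_of_nhds_le_nhds fun ν ↦ ?_)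
  rw [nhds_induced]
  exact ν.tendsto_comap_momentMap

/-- The algebra of polynomials in finitely many coordinates on the Hilbert cube. -/
def cubePolynomials : StarSubalgebra ℝ
    (BoundedContinuousFunction (ℕ × ℕ → Set.Icc (0 : ℝ) 1) ℝ) where
  __ := Algebra.adjoin ℝ (Set.range fun a : ℕ × ℕ ↦ BoundedContinuousFunction.mkOfCompact
    ⟨fun x ↦ (x a : ℝ), by fun_prop⟩)
  star_mem' {f} hf := by rwa [show star f = f from BoundedContinuousFunction.ext fun _ ↦ rfl]

lemma IsPatternFunctional.of_mem_closure
    {f : BoundedContinuousFunction (ℕ × ℕ → Set.Icc (0 : ℝ) 1) ℝ}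
    (hf : f ∈ Submonoid.closure (Set.range fun a : ℕ × ℕ ↦
      BoundedContinuousFunction.mkOfCompact
        (⟨fun x ↦ (x a : ℝ), by fun_prop⟩ : C(ℕ × ℕ → Set.Icc (0 : ℝ) 1, ℝ)))) :
    IsPatternFunctional fun μ ↦ f μ.momentMap := by
  induction hf using Submonoid.closure_induction with
  | mem f hf =>
    obtain ⟨a, rfl⟩ := hf
    exact Permuton.isPatternFunctional_moment a
  | one => exact IsPatternFunctional.one
  | mul f g _ _ hf hg => exact hf.mul hg

lemma map_momentMap_eq {m m' : ProbabilityMeasure Permuton} {k : ℕ}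
    (h : ∀ n : ℕ, k ≤ n → ∀ π : Equiv.Perm (Fin n), epd π m = epd π m') :
    (m : Measure Permuton).map Permuton.momentMap =
      (m' : Measure Permuton).map Permuton.momentMap := by
  have hΦ := Permuton.measurable_momentMap
  have := Measure.isProbabilityMeasure_map (μ := (m : Measure Permuton)) hΦ.aemeasurable
  have := Measure.isProbabilityMeasure_map (μ := (m' : Measure Permuton)) hΦ.aemeasurable
  refine ext_of_forall_mem_subalgebra_integral_eq_of_polish (A := cubePolynomials)
    (fun x y hxy ↦ ?_) fun f hf ↦ ?_
  · obtain ⟨a, ha⟩ := Function.ne_iff.1 hxy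
    exact ⟨_, ⟨_, ⟨_, Algebra.subset_adjoin (Set.mem_range_self a), rfl⟩, rfl⟩,
      fun h ↦ ha (Subtype.ext h)⟩
  · change f ∈ Algebra.adjoin ℝ _ at hf
    rw [← Subalgebra.mem_toSubmodule, Algebra.adjoin_eq_span] at hf
    induction hf using Submodule.span_induction with
    | mem f hf =>
      rw [integral_map hΦ.aemeasurable f.continuous.aestronglyMeasurable,
        integral_map hΦ.aemeasurable f.continuous.aestronglyMeasurable]
      exact (IsPatternFunctional.of_mem_closure hf).integral_eq h
    | zero => simp
    | add f g _ _ hf hg =>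
      simp only [BoundedContinuousFunction.coe_add, Pi.add_apply]
      rw [integral_add (f.integrable _) (g.integrable _),
        integral_add (f.integrable _) (g.integrable _), hf, hg]
    | smul c f _ hf =>
      simp only [BoundedContinuousFunction.coe_smul, integral_smul, hf]

/-- If two random permutons have the same expected pattern densities for all
patterns of all sizes `k ≥ k₁` (for some `k₁ ≥ 1`), then they have the same distribution. -/
theorem subpermutations_characterize_law
    (m m' : MeasureTheory.ProbabilityMeasure Permuton) (k₁ : ℕ) (hk₁ : 1 ≤ k₁)
    (h : ∀ k : ℕ, k₁ ≤ k → ∀ π : Equiv.Perm (Fin k), epd π m = epd π m') :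
    m = m' := by
  refine Subtype.ext (Measure.ext fun s hs ↦ ?_)
  obtain ⟨t, ht, rfl⟩ := Permuton.measurableSpace_le_comap_momentMap s hs
  rw [← Measure.map_apply Permuton.measurable_momentMap ht,
    ← Measure.map_apply Permuton.measurable_momentMap ht]
  exact congrArg (· t) (map_momentMap_eq h)

end
end

section
/- Let C be a substitution-closed permutation class containing both permutations 12 and 21, and let S be the set of simple permutations belonging to C. Then C = ⟨S⟩, i.e. C equals the smallest set of permutations containing the permutation 1 and closed under all substitutions whose skeleton is an increasing permutation, a decreasing permutation, or an element of S. -/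
open MeasureTheory Filter Topology

noncomputable section

/-- `τ` is the substitution `θ[π⁽¹⁾, …, π⁽ᵈ⁾]` of the permutations `πs i` (of sizes `m i`)
in the skeleton `θ`: there is a bijection `e` from the disjoint union of the blocks onto the
positions of `τ`, which is increasing for the lexicographic order on blocks, and such that
values are compared according to `θ` across blocks and according to `πs i` inside block `i`. -/
def IsSubstitution {d N : ℕ} (θ : Equiv.Perm (Fin d)) (m : Fin d → ℕ)
    (πs : ∀ i, Equiv.Perm (Fin (m i))) (τ : Equiv.Perm (Fin N)) : Prop :=
  ∃ e : (Σ i : Fin d, Fin (m i)) ≃ Fin N,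
    (∀ (i j : Fin d) (a : Fin (m i)) (b : Fin (m j)), i ≠ j →
        (e ⟨i, a⟩ < e ⟨j, b⟩ ↔ i < j)) ∧
    (∀ (i : Fin d) (a b : Fin (m i)), e ⟨i, a⟩ < e ⟨i, b⟩ ↔ a < b) ∧
    (∀ (i j : Fin d) (a : Fin (m i)) (b : Fin (m j)), i ≠ j →
        (τ (e ⟨i, a⟩) < τ (e ⟨j, b⟩) ↔ θ i < θ j)) ∧
    (∀ (i : Fin d) (a b : Fin (m i)), τ (e ⟨i, a⟩) < τ (e ⟨i, b⟩) ↔ πs i a < πs i b)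

/-- The increasing permutation `1 2 ⋯ d`. -/
def incrPerm (d : ℕ) : Equiv.Perm (Fin d) := Equiv.refl _

/-- The decreasing permutation `d ⋯ 2 1`. -/
def decrPerm (d : ℕ) : Equiv.Perm (Fin d) :=
  ⟨Fin.rev, Fin.rev, fun i => Fin.rev_rev i, fun i => Fin.rev_rev i⟩

/-- A set of indices is an interval (order-convex set). -/
def IsConvex {n : ℕ} (I : Finset (Fin n)) : Prop :=
  ∀ ⦃i j k : Fin n⦄, i ∈ I → k ∈ I → i ≤ j → j ≤ k → j ∈ I

/-- A permutation is *simple* if it has size greater than `2` and maps no nontrivial interval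
of positions (with between `2` and `n - 1` elements) onto an interval of values. -/
def IsSimple {n : ℕ} (σ : Equiv.Perm (Fin n)) : Prop :=
  2 < n ∧ ∀ I : Finset (Fin n), IsConvex I → IsConvex (I.image σ) →
    2 ≤ I.card → I.card < n → False

/-- `InClosure SS n σ` says that `σ` belongs to `⟨S⟩`, the smallest set of permutations
containing the permutation `1` and closed under all substitutions whose skeleton is an
increasing permutation, a decreasing permutation, or an element of `S`. -/
inductive InClosure (SS : ∀ n : ℕ, Set (Equiv.Perm (Fin n))) : ∀ n : ℕ, Equiv.Perm (Fin n) → Prop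
  | one (σ : Equiv.Perm (Fin 1)) : InClosure SS 1 σ
  | subst {d N : ℕ} (θ : Equiv.Perm (Fin d)) (m : Fin d → ℕ)
      (πs : ∀ i, Equiv.Perm (Fin (m i))) (τ : Equiv.Perm (Fin N))
      (hd : 2 ≤ d) (hθ : θ = incrPerm d ∨ θ = decrPerm d ∨ θ ∈ SS d)
      (hm : ∀ i, 1 ≤ m i) (hπ : ∀ i, InClosure SS (m i) (πs i))
      (hτ : IsSubstitution θ m πs τ) : InClosure SS N τ

/-- The set `⟨S⟩_n` of permutations of size `n` in `⟨S⟩`, as a finset. -/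
noncomputable def closureFinset (SS : ∀ n : ℕ, Set (Equiv.Perm (Fin n))) (n : ℕ) :
    Finset (Equiv.Perm (Fin n)) :=
  (Set.toFinite {σ : Equiv.Perm (Fin n) | InClosure SS n σ}).toFinset

/-- `π` is a pattern of `σ` (`π ≼ σ`). -/
def IsPatternOf {k n : ℕ} (π : Equiv.Perm (Fin k)) (σ : Equiv.Perm (Fin n)) : Prop :=
  ∃ f : Fin k → Fin n, IsOccOf π σ f

/-- A permutation class: a set of permutations downward closed for the pattern order. -/
def IsPermClass (C : ∀ n : ℕ, Set (Equiv.Perm (Fin n))) : Prop :=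
  ∀ {k n : ℕ} (π : Equiv.Perm (Fin k)) (σ : Equiv.Perm (Fin n)),
    σ ∈ C n → IsPatternOf π σ → π ∈ C k

/-- A set of permutations is substitution-closed if it is closed under all substitutions with
skeleton and blocks in the set. -/
def IsSubstClosed (C : ∀ n : ℕ, Set (Equiv.Perm (Fin n))) : Prop :=
  ∀ {d N : ℕ} (θ : Equiv.Perm (Fin d)) (m : Fin d → ℕ)
    (πs : ∀ i, Equiv.Perm (Fin (m i))) (τ : Equiv.Perm (Fin N)),
    θ ∈ C d → (∀ i, 1 ≤ m i) → (∀ i, πs i ∈ C (m i)) →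
    IsSubstitution θ m πs τ → τ ∈ C N

/-- The map `f` onto the blocks exhibits `θ` as a quotient of `σ` by intervals: the fibres of `f`
are intervals of positions, and values in distinct fibres compare as prescribed by `θ`. -/
def IsIntervalQuotient {n d : ℕ} (f : Fin n → Fin d) (σ : Equiv.Perm (Fin n))
    (θ : Equiv.Perm (Fin d)) : Prop :=
  Monotone f ∧ Function.Surjective f ∧
    ∀ x y, f x ≠ f y → (σ x < σ y ↔ θ (f x) < θ (f y))

theorem IsIntervalQuotient.id {n : ℕ} (σ : Equiv.Perm (Fin n)) :
    IsIntervalQuotient _root_.id σ σ :=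
  ⟨monotone_id, Function.surjective_id, fun _ _ _ => Iff.rfl⟩

theorem IsIntervalQuotient.comp {n d k : ℕ} {f : Fin n → Fin d} {g : Fin d → Fin k}
    {σ : Equiv.Perm (Fin n)} {θ : Equiv.Perm (Fin d)} {ρ : Equiv.Perm (Fin k)}
    (hg : IsIntervalQuotient g θ ρ) (hf : IsIntervalQuotient f σ θ) :
    IsIntervalQuotient (g ∘ f) σ ρ :=
  ⟨hg.1.comp hf.1, hg.2.1.comp hf.2.1, fun x y hxy =>
    (hf.2.2 x y fun h => hxy (congrArg g h)).trans (hg.2.2 _ _ hxy)⟩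

theorem IsIntervalQuotient.isPatternOf {n d : ℕ} {f : Fin n → Fin d}
    {σ : Equiv.Perm (Fin n)} {θ : Equiv.Perm (Fin d)} (hf : IsIntervalQuotient f σ θ) :
    IsPatternOf θ σ := by
  obtain ⟨hmono, hsurj, hval⟩ := hf
  obtain ⟨s, hs⟩ := hsurj.hasRightInverse
  refine ⟨s, fun i j hij => ?_, fun i j => ?_⟩
  · by_contra! h
    have := hmono h
    rw [hs, hs] at this
    exact absurd hij this.not_gt
  · rcases eq_or_ne i j with rfl | hij
    · simp
    · have := hval (s i) (s j) (by rwa [hs, hs])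
      rw [hs, hs] at this
      exact this.symm

/-- The pattern of a permutation at a set of positions. -/
theorem exists_isOccOf_orderEmbOfFin {n : ℕ} (σ : Equiv.Perm (Fin n)) (T : Finset (Fin n)) :
    ∃ π : Equiv.Perm (Fin T.card), IsOccOf π σ (T.orderEmbOfFin rfl) := by
  let v := (T.map σ.toEmbedding).orderIsoOfFin (T.card_map σ.toEmbedding)
  let w : T ≃ T.map σ.toEmbedding := σ.subtypeEquiv fun a => by simp
  refine ⟨(T.orderIsoOfFin rfl).toEquiv.trans (w.trans v.symm.toEquiv),
    (T.orderEmbOfFin rfl).strictMono, fun i j => ?_⟩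
  simp only [Equiv.trans_apply]
  exact v.symm.lt_iff_lt

/-- A permutation is a substitution in any of its interval quotients, with blocks its patterns on
the fibres. -/
theorem IsIntervalQuotient.exists_isSubstitution {n d : ℕ} {f : Fin n → Fin d}
    {σ : Equiv.Perm (Fin n)} {θ : Equiv.Perm (Fin d)} (hf : IsIntervalQuotient f σ θ)
    (hd : 2 ≤ d) :
    ∃ (m : Fin d → ℕ) (πs : ∀ i, Equiv.Perm (Fin (m i))), (∀ i, 1 ≤ m i) ∧ (∀ i, m i < n) ∧
      (∀ i, IsPatternOf (πs i) σ) ∧ IsSubstitution θ m πs σ := by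
  obtain ⟨hmono, hsurj, hval⟩ := hf
  let T : Fin d → Finset (Fin n) := fun i => Finset.univ.filter fun x => f x = i
  choose πs hπs using fun i => exists_isOccOf_orderEmbOfFin σ (T i)
  have hfib : ∀ i a, f ((T i).orderEmbOfFin rfl a) = i := fun i a =>
    (Finset.mem_filter.mp ((T i).orderEmbOfFin_mem rfl a)).2
  let e : (Σ i : Fin d, Fin (T i).card) → Fin n := fun p => (T p.1).orderEmbOfFin rfl p.2
  have he : Function.Bijective e := by
    constructor
    · rintro ⟨i, a⟩ ⟨j, b⟩ h
      have hij : i = j := by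
        rw [← hfib i a, ← hfib j b]
        exact congrArg f h
      subst hij
      exact congrArg (Sigma.mk i) (((T i).orderEmbOfFin rfl).injective h)
    · intro x
      have hx : x ∈ Set.range ((T (f x)).orderEmbOfFin rfl) := by
        rw [Finset.range_orderEmbOfFin]
        simp [T]
      obtain ⟨a, ha⟩ := hx
      exact ⟨⟨f x, a⟩, ha⟩
  refine ⟨fun i => (T i).card, πs, fun i => ?_, fun i => ?_, fun i => ⟨_, hπs i⟩,
    Equiv.ofBijective e he, fun i j a b hij => ?_, fun i a b => ?_, fun i j a b hij => ?_,
    fun i a b => ((hπs i).2 a b).symm⟩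
  · obtain ⟨x, hx⟩ := hsurj i
    exact Finset.card_pos.mpr ⟨x, by simp [T, hx]⟩
  · have : Nontrivial (Fin d) := Fin.nontrivial_iff_two_le.mpr hd
    obtain ⟨j, hj⟩ := exists_ne i
    obtain ⟨x, hx⟩ := hsurj j
    have hlt := Finset.card_lt_univ_of_notMem (s := T i) (x := x) (by simp [T, hx, hj])
    simpa using hlt
  · have hlt : ∀ {k l : Fin d} (a : Fin (T k).card) (b : Fin (T l).card), k < l →
        (T k).orderEmbOfFin rfl a < (T l).orderEmbOfFin rfl b := fun {k l} a b hkl => by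
      by_contra! h
      have := hmono h
      rw [hfib, hfib] at this
      exact absurd hkl this.not_gt
    refine ⟨fun h => ?_, hlt a b⟩
    by_contra hn
    exact absurd h (hlt b a (lt_of_le_of_ne (not_lt.mp hn) hij.symm)).not_gt
  · exact ((T i).orderEmbOfFin rfl).lt_iff_lt
  · have := hval ((T i).orderEmbOfFin rfl a) ((T j).orderEmbOfFin rfl b) (by rwa [hfib, hfib])
    rwa [hfib, hfib] at this

/-- An interval of a permutation can be contracted to a point. -/
theorem exists_isIntervalQuotient_of_isConvex {n : ℕ} (σ : Equiv.Perm (Fin n))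
    (I : Finset (Fin n)) (hI : IsConvex I) (hσI : IsConvex (I.image σ)) (h2 : 2 ≤ I.card)
    (hlt : I.card < n) :
    ∃ d, 2 ≤ d ∧ d < n ∧ ∃ (f : Fin n → Fin d) (θ : Equiv.Perm (Fin d)),
      IsIntervalQuotient f σ θ := by
  obtain ⟨p, hp⟩ : I.Nonempty := Finset.card_pos.mp (by omega)
  let T := insert p Iᶜ
  have hT : T.card = n - I.card + 1 := by
    rw [Finset.card_insert_of_notMem (by simpa using hp), Finset.card_compl, Fintype.card_fin]
  obtain ⟨θ, -, hθ⟩ := exists_isOccOf_orderEmbOfFin σ T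
  let r : Fin n → T := fun x => if hx : x ∈ I then ⟨p, by simp [T]⟩ else ⟨x, by simp [T, hx]⟩
  have hr : ∀ x, (x ∈ I ∧ (r x : Fin n) = p) ∨ (x ∉ I ∧ (r x : Fin n) = x) := fun x => by
    by_cases hx : x ∈ I <;> simp [r, hx]
  let g := T.orderIsoOfFin rfl
  have hg : ∀ x, T.orderEmbOfFin rfl (g.symm (r x)) = r x := fun x => by
    rw [← Finset.coe_orderIsoOfFin_apply]
    exact congrArg Subtype.val (g.apply_symm_apply (r x))
  refine ⟨T.card, by omega, by omega, fun x => g.symm (r x), θ, fun x y hxy => ?_, fun i => ?_,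
    fun x y hxy => ?_⟩
  · refine g.symm.monotone (Subtype.coe_le_coe.mp ?_)
    rcases hr x with ⟨hx, ex⟩ | ⟨hx, ex⟩ <;> rcases hr y with ⟨hy, ey⟩ | ⟨hy, ey⟩ <;> rw [ex, ey]
    · by_contra! h
      exact hy (hI hx hp hxy h.le)
    · by_contra! h
      exact hx (hI hp hy h.le hxy)
    · exact hxy
  · refine ⟨g i, ?_⟩
    have : r (g i) = g i := Subtype.ext <| by
      rcases hr (g i) with ⟨hx, ex⟩ | ⟨-, ex⟩
      · have hmem := (g i).2
        simp only [T, Finset.mem_insert, Finset.mem_compl] at hmem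
        rw [ex]
        tauto
      · exact ex
    simp [this]
  · have hsep : ∀ {z a b}, z ∉ I → a ∈ I → b ∈ I → σ z < σ a → σ z < σ b := by
      intro z a b hz ha hb hza
      by_contra! h
      obtain ⟨w, hw, hwz⟩ := Finset.mem_image.mp (hσI (Finset.mem_image_of_mem σ hb)
        (Finset.mem_image_of_mem σ ha) h hza.le)
      exact hz (σ.injective hwz ▸ hw)
    have hsep' : ∀ {z a b}, z ∉ I → a ∈ I → b ∈ I → σ a < σ z → σ b < σ z := by
      intro z a b hz ha hb hza
      by_contra! h
      obtain ⟨w, hw, hwz⟩ := Finset.mem_image.mp (hσI (Finset.mem_image_of_mem σ ha)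
        (Finset.mem_image_of_mem σ hb) hza.le h)
      exact hz (σ.injective hwz ▸ hw)
    rw [hθ, hg, hg]
    rcases hr x with ⟨hx, ex⟩ | ⟨hx, ex⟩ <;> rcases hr y with ⟨hy, ey⟩ | ⟨hy, ey⟩
    · exact absurd (congrArg g.symm (Subtype.ext (ex.trans ey.symm))) hxy
    · rw [ex, ey]
      exact ⟨hsep' hy hx hp, hsep' hy hp hx⟩
    · rw [ex, ey]
      exact ⟨hsep hx hy hp, hsep hx hp hy⟩
    · rw [ex, ey]

/-- Every permutation of size at least two has an interval quotient that is simple or of size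
two. -/
theorem exists_isIntervalQuotient_isSimple {n : ℕ} (hn : 2 ≤ n) (σ : Equiv.Perm (Fin n)) :
    ∃ d, 2 ≤ d ∧ ∃ (f : Fin n → Fin d) (θ : Equiv.Perm (Fin d)), IsIntervalQuotient f σ θ ∧
      (θ = incrPerm d ∨ θ = decrPerm d ∨ IsSimple θ) := by
  classical
  have hex : ∃ d, 2 ≤ d ∧ ∃ (f : Fin n → Fin d) (θ : Equiv.Perm (Fin d)),
      IsIntervalQuotient f σ θ := ⟨n, hn, _root_.id, σ, .id σ⟩
  obtain ⟨hd, f, θ, hf⟩ := Nat.find_spec hex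
  have hmin := fun k => Nat.find_min hex (m := k)
  generalize Nat.find hex = d at *
  refine ⟨d, hd, f, θ, hf, ?_⟩
  rcases hd.eq_or_lt with rfl | hd
  · have : ∀ θ : Equiv.Perm (Fin 2), θ = incrPerm 2 ∨ θ = decrPerm 2 := by decide
    exact (this θ).imp_right Or.inl
  · refine .inr (.inr ⟨hd, fun I hI hθI h2 hlt => ?_⟩)
    obtain ⟨k, hk, hkd, g, ρ, hg⟩ := exists_isIntervalQuotient_of_isConvex θ I hI hθI h2 hlt
    exact hmin k hkd ⟨hk, g ∘ f, ρ, hg.comp hf⟩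

/-- A substitution-closed class containing `θ` of size two contains every monotone permutation
of the same direction. -/
theorem mem_of_forall_lt_iff {C : ∀ n : ℕ, Set (Equiv.Perm (Fin n))} (hclass : IsPermClass C)
    (hsubst : IsSubstClosed C) {θ : Equiv.Perm (Fin 2)} (hθ : θ ∈ C 2) :
    ∀ {n : ℕ}, 1 ≤ n → ∀ σ : Equiv.Perm (Fin n),
      (∀ i j, i < j → (σ i < σ j ↔ θ 0 < θ 1)) → σ ∈ C n := by
  intro n
  induction n using Nat.strong_induction_on with
  | h n ih =>
    intro hn σ hσ
    rcases hn.eq_or_lt with rfl | hn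
    · exact hclass σ θ hθ ⟨fun _ => 0, Subsingleton.strictMono _, fun i j => by
        simp [Subsingleton.elim i j]⟩
    · have : NeZero n := ⟨by omega⟩
      have hf : IsIntervalQuotient (fun x : Fin n => if x = 0 then (0 : Fin 2) else 1) σ θ := by
        refine ⟨fun x y hxy => ?_, fun i => ?_, fun x y hxy => ?_⟩
        · by_cases hx : x = 0
          · simp [hx]
          · have hy : y ≠ 0 := fun h => hx (by simpa [h] using hxy)
            simp [hx, hy]
        · fin_cases i
          · exact ⟨0, by simp⟩
          · exact ⟨⟨1, hn⟩, by simp [Fin.ext_iff]⟩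
        · by_cases hx : x = 0 <;> by_cases hy : y = 0
          · simp [hx, hy] at hxy
          · simpa [hx, hy] using hσ 0 y (Fin.pos_iff_ne_zero.mpr hy)
          · have h := hσ 0 x (Fin.pos_iff_ne_zero.mpr hx)
            have hne : σ 0 ≠ σ x := fun h => hx (σ.injective h).symm
            have hne' : θ 0 ≠ θ 1 := fun h => absurd (θ.injective h) (by decide)
            simp only [hx, hy, if_true, if_false]
            grind
          · simp [hx, hy] at hxy
      obtain ⟨m, πs, hm, hmn, hpat, hsub⟩ := hf.exists_isSubstitution le_rfl
      refine hsubst θ m πs σ hθ hm (fun i => ih (m i) (hmn i) (hm i) _ fun a b hab => ?_) hsub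
      obtain ⟨s, hs, hsv⟩ := hpat i
      exact (hsv a b).trans (hσ _ _ (hs hab))

/-- A substitution-closed permutation class `C` containing `12` and `21`
equals `⟨S⟩`, where `S` is the set of simple permutations of `C`. -/
theorem substitution_closed_class_eq_closure_of_its_simples
    (C : ∀ n : ℕ, Set (Equiv.Perm (Fin n)))
    (hclass : IsPermClass C) (hsubst : IsSubstClosed C)
    (h12 : incrPerm 2 ∈ C 2) (h21 : decrPerm 2 ∈ C 2) :
    ∀ n : ℕ, 1 ≤ n → ∀ σ : Equiv.Perm (Fin n),
      σ ∈ C n ↔ InClosure (fun d => {α ∈ C d | IsSimple α}) n σ := by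
  have hsingle : ∀ σ : Equiv.Perm (Fin 1), σ ∈ C 1 := fun σ =>
    mem_of_forall_lt_iff hclass hsubst h12 le_rfl σ fun i j hij =>
      absurd (Subsingleton.elim i j) hij.ne
  intro n hn σ
  constructor
  · induction n using Nat.strong_induction_on with
    | h n ih =>
      intro hσ
      rcases hn.eq_or_lt with rfl | hn
      · exact .one σ
      · obtain ⟨d, hd, f, θ, hf, hθ⟩ := exists_isIntervalQuotient_isSimple hn σ
        obtain ⟨m, πs, hm, hmn, hpat, hsub⟩ := hf.exists_isSubstitution hd
        have hθC : θ ∈ C d := hclass θ σ hσ hf.isPatternOf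
        exact .subst θ m πs σ hd (hθ.imp_right (Or.imp_right fun h => ⟨hθC, h⟩)) hm
          (fun i => ih (m i) (hmn i) (hm i) _ (hclass _ σ hσ (hpat i))) hsub
  · intro h
    clear hn
    induction h with
    | one σ => exact hsingle σ
    | subst θ m πs τ hd hθ hm _ hτ ih =>
      refine hsubst θ m πs τ ?_ hm ih hτ
      rcases hθ with rfl | rfl | hθ
      · exact mem_of_forall_lt_iff hclass hsubst h12 (by omega) _ fun i j hij => by
          simpa [incrPerm] using hij
      · exact mem_of_forall_lt_iff hclass hsubst h21 (by omega) _ fun i j hij => by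
          simpa [decrPerm] using hij.le
      · exact hθ.1

end
end

section
/- Let t be a substitution tree with k leaves and let I be a nonempty subset of its leaves (identified with a subset of {1,…,k} via the left-to-right numbering of the leaves). Then pat_I(perm(t)) = perm(t_I), i.e. the pattern of the permutation encoded by t at the positions I equals the permutation encoded by the induced tree t_I. -/
open MeasureTheory Filter Topology

noncomputable section

/-- Substitution trees: rooted plane trees whose internal nodes have `d ≥ 2` children and are
labeled by a permutation of size `d`. -/
inductive STree : Type
  | leaf : STree
  | node {d : ℕ} (hd : 2 ≤ d) (θ : Equiv.Perm (Fin d)) (c : Fin d → STree) : STree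

/-- The size of a substitution tree: its number of leaves. -/
def STree.size : STree → ℕ
  | .leaf => 1
  | .node _ _ c => ∑ i, (c i).size

/-- `EncodesPerm t σ`: the substitution tree `t` encodes the permutation `σ`
(a leaf encodes the permutation `1`, and a node labeled `θ` with subtrees `c i` encoding
`πs i` encodes the substitution `θ[πs 1, …, πs d]`). -/
inductive EncodesPerm : STree → ∀ {n : ℕ}, Equiv.Perm (Fin n) → Prop
  | leaf (σ : Equiv.Perm (Fin 1)) : EncodesPerm .leaf σ
  | node {d : ℕ} (hd : 2 ≤ d) (θ : Equiv.Perm (Fin d)) (c : Fin d → STree)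
      {m : Fin d → ℕ} (πs : ∀ i, Equiv.Perm (Fin (m i))) {N : ℕ} (τ : Equiv.Perm (Fin N))
      (hc : ∀ i, EncodesPerm (c i) (πs i)) (hτ : IsSubstitution θ m πs τ) :
      EncodesPerm (.node hd θ c) τ

/-- The pattern `pat_I (σ)` of `σ` at the set of positions `I`: the permutation of `Fin I.card`
sending the rank (in `I`) of a position to the rank (among the values `σ '' I`) of its value. -/
def patAt {n : ℕ} (σ : Equiv.Perm (Fin n)) (I : Finset (Fin n)) : Equiv.Perm (Fin I.card) :=
  (I.orderIsoOfFin rfl).toEquiv.trans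
    ((Equiv.Set.image (⇑σ) (↑I) σ.injective).trans
      ((Equiv.setCongr (Finset.coe_image (f := ⇑σ) (s := I)).symm).trans
        ((I.image σ).orderIsoOfFin
          (Finset.card_image_of_injective I σ.injective)).toEquiv.symm))

/-- Given block sizes `m : Fin d → ℕ` and a set `I` of leaves of the concatenation, the subset
of leaves of block `i` that are marked (in the block's own coordinates).  Leaf `p` of the
concatenation belongs to block `i` at local position `a` when `p = m 0 + ⋯ + m (i-1) + a`. -/
def blockMarks {d : ℕ} (m : Fin d → ℕ) (I : Finset (Fin (∑ i, m i))) (i : Fin d) :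
    Finset (Fin (m i)) :=
  Finset.univ.filter fun a : Fin (m i) =>
    ∃ p ∈ I, (p : ℕ) = (∑ j ∈ Finset.univ.filter (· < i), m j) + (a : ℕ)

/-- The set of blocks containing at least one marked leaf. -/
def touchedBlocks {d : ℕ} (m : Fin d → ℕ) (I : Finset (Fin (∑ i, m i))) : Finset (Fin d) :=
  Finset.univ.filter fun i => (blockMarks m I i).Nonempty

/-- `IsInduced t I t'`: the tree induced in `t` by the nonempty set of marked leaves `I` is `t'`.
Its leaves are the leaves of `t` in `I`, its internal nodes are the first common ancestors of
at least two leaves of `I`, with inherited order, and labels are the patterns of the original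
labels at the children having a marked descendant. -/
inductive IsInduced : (t : STree) → Finset (Fin t.size) → STree → Prop
  | leaf (I : Finset (Fin STree.leaf.size)) (hI : I.Nonempty) : IsInduced STree.leaf I STree.leaf
  | single {d : ℕ} (hd : 2 ≤ d) (θ : Equiv.Perm (Fin d)) (c : Fin d → STree)
      (I : Finset (Fin (∑ i, (c i).size))) (j : Fin d) (t' : STree)
      (hj : touchedBlocks (fun i => (c i).size) I = {j})
      (h : IsInduced (c j) (blockMarks (fun i => (c i).size) I j) t') :
      IsInduced (STree.node hd θ c) I t'
  | branch {d : ℕ} (hd : 2 ≤ d) (θ : Equiv.Perm (Fin d)) (c : Fin d → STree)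
      (I : Finset (Fin (∑ i, (c i).size)))
      (h2 : 2 ≤ (touchedBlocks (fun i => (c i).size) I).card)
      (c' : Fin (touchedBlocks (fun i => (c i).size) I).card → STree)
      (hc' : ∀ j : Fin (touchedBlocks (fun i => (c i).size) I).card,
        IsInduced (c ((touchedBlocks (fun i => (c i).size) I).orderIsoOfFin rfl j))
          (blockMarks (fun i => (c i).size) I
            ((touchedBlocks (fun i => (c i).size) I).orderIsoOfFin rfl j)) (c' j)) :
      IsInduced (STree.node hd θ c) I
        (STree.node h2 (patAt θ (touchedBlocks (fun i => (c i).size) I)) c')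

/-- `π` is the pattern of `σ` at the set of positions `I`:
there is a strictly increasing enumeration of `I` along which the values of `σ` are in the
same relative order as the values of `π`. -/
def IsPatternAt {k n : ℕ} (π : Equiv.Perm (Fin k)) (σ : Equiv.Perm (Fin n))
    (I : Finset (Fin n)) : Prop :=
  ∃ f : Fin k → Fin n, StrictMono f ∧ Finset.univ.image f = I ∧
    ∀ i j : Fin k, π i < π j ↔ σ (f i) < σ (f j)

theorem EncodesPerm.size_eq {t : STree} {n : ℕ} {σ : Equiv.Perm (Fin n)}
    (h : EncodesPerm t σ) : n = t.size := by
  induction h with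
  | leaf σ => rfl
  | node hd θ c πs τ hc hτ ih =>
    obtain ⟨e, -⟩ := hτ
    have hcard := Fintype.card_congr e
    simp only [Fintype.card_sigma, Fintype.card_fin] at hcard
    rw [← hcard]
    exact Finset.sum_congr rfl fun i _ => ih i

theorem EncodesPerm.exists_isSubstitution {d n : ℕ} {hd : 2 ≤ d} {θ : Equiv.Perm (Fin d)}
    {c : Fin d → STree} {τ : Equiv.Perm (Fin n)} (h : EncodesPerm (.node hd θ c) τ) :
    ∃ πs : ∀ i, Equiv.Perm (Fin (c i).size),
      (∀ i, EncodesPerm (c i) (πs i)) ∧ IsSubstitution θ (fun i => (c i).size) πs τ := by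
  cases h with
  | @node _ _ _ _ m πs _ _ hc hτ =>
    obtain rfl : m = fun i => (c i).size := funext fun i => (hc i).size_eq
    exact ⟨πs, hc, hτ⟩

/-- The position of an element of a concatenation of blocks is the total size of the preceding
blocks plus its position inside its own block. -/
theorem val_of_block_increasing {d N : ℕ} {m : Fin d → ℕ}
    (e : (Σ i : Fin d, Fin (m i)) ≃ Fin N)
    (hne : ∀ (i j : Fin d) (a : Fin (m i)) (b : Fin (m j)), i ≠ j →
      (e ⟨i, a⟩ < e ⟨j, b⟩ ↔ i < j))
    (heq : ∀ (i : Fin d) (a b : Fin (m i)), e ⟨i, a⟩ < e ⟨i, b⟩ ↔ a < b)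
    (i : Fin d) (a : Fin (m i)) :
    (e ⟨i, a⟩ : ℕ) = (∑ j ∈ Finset.univ.filter (· < i), m j) + (a : ℕ) := by
  have hIio : Finset.Iio (e ⟨i, a⟩) =
      ((Finset.univ.filter (· < i)).sigma (fun j => (Finset.univ : Finset (Fin (m j)))) ∪
        (Finset.Iio a).map (Function.Embedding.sigmaMk i)).map e.toEmbedding := by
    ext p
    obtain ⟨⟨j, b⟩, rfl⟩ := e.surjective p
    rw [← Equiv.coe_toEmbedding e, Finset.mem_map', Equiv.coe_toEmbedding]
    rcases eq_or_ne j i with rfl | hji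
    · simp [heq]
    · simp [hne j i b a hji, Ne.symm hji]
  rw [← Fin.card_Iio, hIio, Finset.card_map, Finset.card_union_of_disjoint]
  · simp
  · rw [Finset.disjoint_left]
    rintro ⟨j, b⟩ hj hj'
    simp only [Finset.mem_sigma, Finset.mem_filter, Finset.mem_univ, true_and, and_true] at hj
    simp only [Finset.mem_map, Function.Embedding.sigmaMk_apply, Sigma.mk.injEq] at hj'
    obtain ⟨_, _, rfl, _⟩ := hj'
    exact lt_irrefl _ hj

theorem mem_blockMarks_iff {d : ℕ} {m : Fin d → ℕ} (e : (Σ i : Fin d, Fin (m i)) ≃ Fin (∑ i, m i))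
    (hne : ∀ (i j : Fin d) (a : Fin (m i)) (b : Fin (m j)), i ≠ j →
      (e ⟨i, a⟩ < e ⟨j, b⟩ ↔ i < j))
    (heq : ∀ (i : Fin d) (a b : Fin (m i)), e ⟨i, a⟩ < e ⟨i, b⟩ ↔ a < b)
    (I : Finset (Fin (∑ i, m i))) (i : Fin d) (a : Fin (m i)) :
    a ∈ blockMarks m I i ↔ e ⟨i, a⟩ ∈ I := by
  simp only [blockMarks, Finset.mem_filter, Finset.mem_univ, true_and,
    ← val_of_block_increasing e hne heq, ← Fin.ext_iff, exists_eq_right]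

theorem mem_touchedBlocks_of_mem_blockMarks {d : ℕ} {m : Fin d → ℕ} {I : Finset (Fin (∑ i, m i))}
    {i : Fin d} {a : Fin (m i)} (ha : a ∈ blockMarks m I i) : i ∈ touchedBlocks m I :=
  Finset.mem_filter.2 ⟨Finset.mem_univ _, a, ha⟩

theorem patAt_lt_patAt_iff {n : ℕ} (σ : Equiv.Perm (Fin n)) (I : Finset (Fin n))
    (i j : Fin I.card) :
    patAt σ I i < patAt σ I j ↔
      σ (I.orderIsoOfFin rfl i) < σ (I.orderIsoOfFin rfl j) :=
  ((I.image σ).orderIsoOfFin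
    (Finset.card_image_of_injective I σ.injective)).symm.lt_iff_lt

theorem IsInduced.isPatternAt {t t' : STree} {I : Finset (Fin t.size)} (h : IsInduced t I t')
    {σ : Equiv.Perm (Fin t.size)} (hσ : EncodesPerm t σ)
    {k : ℕ} {π : Equiv.Perm (Fin k)} (hπ : EncodesPerm t' π) : IsPatternAt π σ I := by
  induction h generalizing k with
  | leaf I hI =>
    cases hπ
    have : Subsingleton (Fin STree.leaf.size) := inferInstanceAs (Subsingleton (Fin 1))
    refine ⟨id, strictMono_id, ?_, fun i j => ?_⟩
    · obtain ⟨p, hp⟩ := hI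
      ext q
      obtain rfl := Subsingleton.elim p q
      exact iff_of_true (Finset.mem_image_of_mem id (Finset.mem_univ _)) hp
    · obtain rfl : i = j := Subsingleton.elim i j
      simp
  | single hd θ c I j t' hj h ih =>
    obtain ⟨ρ, hρ, e, hne, heq, -, hσeq⟩ := hσ.exists_isSubstitution
    have hmem := mem_blockMarks_iff e hne heq I
    obtain ⟨f, hf, hfI, hfπ⟩ := ih (hρ j) hπ
    refine ⟨fun x => e ⟨j, f x⟩, fun x y hxy => (heq _ _ _).2 (hf hxy), ?_, fun x y => ?_⟩
    · ext p
      obtain ⟨⟨i, a⟩, rfl⟩ := e.surjective p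
      simp only [Finset.mem_image, Finset.mem_univ, true_and, EmbeddingLike.apply_eq_iff_eq]
      constructor
      · rintro ⟨x, hx⟩
        rw [← hx]
        refine (hmem _ _).1 ?_
        rw [← hfI]
        exact Finset.mem_image_of_mem _ (Finset.mem_univ _)
      · intro hp
        have ha := (hmem i a).2 hp
        obtain rfl : i = j := by
          simpa [hj] using mem_touchedBlocks_of_mem_blockMarks ha
        rw [← hfI] at ha
        obtain ⟨x, -, rfl⟩ := Finset.mem_image.1 ha
        exact ⟨x, rfl⟩
    · exact (hfπ x y).trans (hσeq _ _ _).symm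
  | branch hd θ c I h2 c' hc' ih =>
    obtain ⟨ρ, hρ, e, hne, heq, hσne, hσeq⟩ := hσ.exists_isSubstitution
    obtain ⟨ρ', hρ', e', hne', heq', hπne, hπeq⟩ := hπ.exists_isSubstitution
    have hmem := mem_blockMarks_iff e hne heq I
    set T := (touchedBlocks (fun i => (c i).size) I).orderIsoOfFin rfl
    choose f hf hfI hfπ using fun j => ih j (hρ _) (hρ' j)
    have hT {i j} (hij : i ≠ j) : (T i).1 ≠ (T j).1 := fun h =>
      hij (T.injective (Subtype.ext h))
    obtain ⟨g, hg⟩ : ∃ g : Fin k → Fin (STree.node hd θ c).size,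
        ∀ i a, g (e' ⟨i, a⟩) = e ⟨T i, f i a⟩ :=
      ⟨fun p => e ⟨T (e'.symm p).1, f _ (e'.symm p).2⟩, fun i a => by
        beta_reduce
        rw [Equiv.symm_apply_apply]⟩
    refine ⟨g, fun p q hpq => ?_, ?_, fun p q => ?_⟩
    · obtain ⟨⟨i, a⟩, rfl⟩ := e'.surjective p
      obtain ⟨⟨j, b⟩, rfl⟩ := e'.surjective q
      rw [hg, hg]
      rcases eq_or_ne i j with rfl | hij
      · exact (heq _ _ _).2 (hf i ((heq' _ _ _).1 hpq))
      · exact (hne _ _ _ _ (hT hij)).2 (T.strictMono ((hne' _ _ _ _ hij).1 hpq))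
    · ext p
      obtain ⟨⟨i, a⟩, rfl⟩ := e.surjective p
      simp only [Finset.mem_image, Finset.mem_univ, true_and]
      constructor
      · rintro ⟨x, hx⟩
        obtain ⟨⟨j, b⟩, rfl⟩ := e'.surjective x
        rw [← hx, hg]
        refine (hmem _ _).1 ?_
        rw [← hfI]
        exact Finset.mem_image_of_mem _ (Finset.mem_univ _)
      · intro hp
        have ha := (hmem i a).2 hp
        obtain ⟨j, hj⟩ := T.surjective ⟨i, mem_touchedBlocks_of_mem_blockMarks ha⟩
        obtain rfl : (T j).1 = i := congrArg Subtype.val hj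
        rw [← hfI] at ha
        obtain ⟨x, -, rfl⟩ := Finset.mem_image.1 ha
        exact ⟨e' ⟨j, x⟩, hg j x⟩
    · obtain ⟨⟨i, a⟩, rfl⟩ := e'.surjective p
      obtain ⟨⟨j, b⟩, rfl⟩ := e'.surjective q
      rw [hg, hg]
      rcases eq_or_ne i j with rfl | hij
      · exact (hπeq _ _ _).trans ((hfπ i a b).trans (hσeq _ _ _).symm)
      · exact (hπne _ _ _ _ hij).trans
          ((patAt_lt_patAt_iff _ _ _ _).trans (hσne _ _ _ _ (hT hij)).symm)

/-- For a substitution tree `t` and a nonempty subset `I` of its leaves,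
`pat_I (perm t) = perm (t_I)`: the pattern at positions `I` of the permutation encoded by `t`
is the permutation encoded by the induced tree `t_I`. -/
theorem pattern_of_encoded_perm_eq_perm_of_induced_tree
    (t : STree) (I : Finset (Fin t.size)) (hI : I.Nonempty) (t' : STree)
    (hind : IsInduced t I t')
    (σ : Equiv.Perm (Fin t.size)) (hσ : EncodesPerm t σ)
    (π : Equiv.Perm (Fin t'.size)) (hπ : EncodesPerm t' π) :
    IsPatternAt π σ I :=
  hind.isPatternAt hσ hπ

end
end
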